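/- For n ≥ 373, p_{eu}^{od}(n) − p_{od}^{eu}(n) ≥ 1; more precisely, there exists a partition of n with distinct odd parts all greater than all even parts (even parts unrestricted) that is not in the image of any injection constructed from partitions with even parts exceeding distinct odd parts, namely (2k+3, 2k+1, 2k+j−8, 2, 2) when n = 6k+j with j ∈ {1,3,5}, or (2k+1, 2k−1, 2k+j−7, 3, 2, 2) when n = 6k+j with j ∈ {0,2,4}. -/

import Mathlib

def OddDistinctGtEven (M : Multiset ℕ) : Prop :=
  (M.filter (fun x => Odd x)).Nodup ∧
  ∀ o ∈ M, Odd o → ∀ e ∈ M, Even e → e < o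

def EvenGtOddDistinct (M : Multiset ℕ) : Prop :=
  (M.filter (fun x => Odd x)).Nodup ∧
  ∀ e ∈ M, Even e → ∀ o ∈ M, Odd o → o < e

/-- number of partitions of n with odd parts distinct and all greater than even parts -/
noncomputable def peuod (n : ℕ) : ℕ := Nat.card {p : n.Partition // OddDistinctGtEven p.parts}

/-- number of partitions of n with even parts all greater than the distinct odd parts -/
noncomputable def podeu (n : ℕ) : ℕ := Nat.card {p : n.Partition // EvenGtOddDistinct p.parts}

section partitionCounts

open Finset

theorem card_restricted_filter_mem (q : ℕ → Prop) [DecidablePred q] {a : ℕ} (ha : 0 < a)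
    (hq : q a) (m : ℕ) :
    #{p ∈ Nat.Partition.restricted (m + a) q | a ∈ p.parts} = #(Nat.Partition.restricted m q) := by
  symm
  refine Finset.card_bij
    (fun p _ => (⟨a ::ₘ p.parts, ?_, ?_⟩ : Nat.Partition (m + a))) ?_ ?_ ?_
  · intro i hi
    rcases Multiset.mem_cons.1 hi with rfl | hi
    exacts [ha, p.parts_pos hi]
  · rw [Multiset.sum_cons, p.parts_sum, add_comm]
  · intro p hp
    simp only [Nat.Partition.restricted, mem_filter, mem_univ, true_and] at hp ⊢
    exact ⟨fun i hi => (Multiset.mem_cons.1 hi).elim (fun h => h ▸ hq) (hp i),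
      Multiset.mem_cons_self _ _⟩
  · intro p _ p' _ h
    have := congrArg Nat.Partition.parts h
    exact Nat.Partition.ext ((Multiset.cons_inj_right a).1 this)
  · intro p hp
    simp only [Nat.Partition.restricted, mem_filter, mem_univ, true_and] at hp
    refine ⟨⟨p.parts.erase a, fun hi => p.parts_pos (Multiset.mem_of_mem_erase hi), ?_⟩, ?_, ?_⟩
    · have := p.parts_sum
      rw [← Multiset.cons_erase hp.2, Multiset.sum_cons] at this
      omega
    · simp only [Nat.Partition.restricted, mem_filter, mem_univ, true_and]
      exact fun i hi => hp.1 i (Multiset.mem_of_mem_erase hi)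
    · exact Nat.Partition.ext (Multiset.cons_erase hp.2)

theorem card_restricted_ne_one_add (m : ℕ) :
    #(Nat.Partition.restricted (m + 1) (· ≠ 1)) + Fintype.card m.Partition =
      Fintype.card (m + 1).Partition := by
  have h := card_restricted_filter_mem (fun _ => True) one_pos trivial m
  have h' : ∀ k, Nat.Partition.restricted k (fun _ => True) = univ := by
    intro k; simp [Nat.Partition.restricted]
  rw [h', h', card_univ] at h
  rw [← h, ← Finset.card_univ (α := (m + 1).Partition),
    ← Finset.card_filter_add_card_filter_not (s := (univ : Finset (m + 1).Partition))
      (fun p => 1 ∈ p.parts), add_comm]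
  congr 2
  ext p
  simp only [Nat.Partition.restricted, mem_filter, mem_univ, true_and]
  exact ⟨fun h h1 => h 1 h1 rfl, fun h i hi h1 => h (h1 ▸ hi)⟩

theorem card_partition_mono : Monotone fun m : ℕ => Fintype.card m.Partition :=
  monotone_nat_of_le_succ fun m => by
    have := card_restricted_ne_one_add m
    omega

/-- The number of partitions of `m` into parts of size at most `t`. -/
def partsLECard (t m : ℕ) : ℕ := #(Nat.Partition.restricted m (· ≤ t))

theorem partsLECard_succ (t m : ℕ) :
    partsLECard (t + 1) m =
      partsLECard t m + if m < t + 1 then 0 else partsLECard (t + 1) (m - (t + 1)) := by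
  have hsplit := Finset.card_filter_add_card_filter_not
    (s := Nat.Partition.restricted m (· ≤ t + 1)) (fun p => t + 1 ∈ p.parts)
  have hnot : {p ∈ Nat.Partition.restricted m (· ≤ t + 1) | ¬ t + 1 ∈ p.parts} =
      Nat.Partition.restricted m (· ≤ t) := by
    ext p
    simp only [Nat.Partition.restricted, mem_filter, mem_univ, true_and]
    refine ⟨fun h i hi => ?_, fun h => ⟨fun i hi => (h i hi).trans t.le_succ, fun hi => ?_⟩⟩
    · have h1 := h.1 i hi
      have h2 : i ≠ t + 1 := fun e => h.2 (e ▸ hi)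
      omega
    · have := h _ hi
      omega
  rw [hnot] at hsplit
  unfold partsLECard
  rw [← hsplit, add_comm]
  congr 1
  split_ifs with hm
  · rw [card_eq_zero, filter_eq_empty_iff]
    intro p _ hp
    have := Multiset.single_le_sum (fun x _ => Nat.zero_le x) _ hp
    rw [p.parts_sum] at this
    omega
  · obtain ⟨k, rfl⟩ := Nat.exists_eq_add_of_le' (not_lt.1 hm)
    rw [Nat.add_sub_cancel]
    exact card_restricted_filter_mem (· ≤ t + 1) t.succ_pos le_rfl k

theorem partsLECard_of_le {t m : ℕ} (h : m ≤ t) : partsLECard t m = Fintype.card m.Partition := by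
  rw [partsLECard, ← Finset.card_univ]
  congr 1
  ext p
  simp only [Nat.Partition.restricted, mem_filter, mem_univ, true_and, iff_true]
  intro i hi
  have := Multiset.single_le_sum (fun x _ => Nat.zero_le x) _ hi
  rw [p.parts_sum] at this
  omega

theorem partsLECard_zero (m : ℕ) : partsLECard 0 m = if m = 0 then 1 else 0 := by
  split_ifs with h
  · subst h
    rw [partsLECard_of_le le_rfl]
    simp
  · rw [partsLECard, card_eq_zero]
    simp only [Nat.Partition.restricted, filter_eq_empty_iff]
    intro p _ hp
    apply h
    rw [← p.parts_sum]
    exact Multiset.sum_eq_zero fun i hi => Nat.le_zero.1 (hp i hi)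

theorem nonpos_of_initial_bounds (e : ℕ → ℕ → ℤ) (K : ℕ) (C : ℤ) (hK : 0 < K)
    (hrec : ∀ t m, e (t + 1) m = e t m + if m < t + 1 then 0 else e (t + 1) (m - (t + 1)))
    (hzero : ∀ m, K ≤ m → e 0 m ≤ 0)
    (hbase : ∀ t m, t ≤ K → K ≤ m → m < 2 * K → e t m ≤ 0)
    (hbaseK : ∀ m, K ≤ m → m < 2 * K → e K m ≤ -C)
    (hsum : ∑ j ∈ range K, max (e K j) 0 ≤ C)
    {t m : ℕ} (ht : K ≤ t) (hm : K ≤ m) : e t m ≤ 0 := by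
  have small : ∀ m, K ≤ m → (∀ t ≤ K, e t m ≤ 0) ∧ e K m ≤ -C := by
    intro m
    induction m using Nat.strong_induction_on with
    | _ m ih =>
      intro hm
      by_cases hlt : m < 2 * K
      · exact ⟨fun t ht => hbase t m ht hm hlt, hbaseK m hm hlt⟩
      · have hle : ∀ t ≤ K, e t m ≤ 0 := by
          intro t
          induction t with
          | zero => exact fun _ => hzero m hm
          | succ t iht =>
            intro ht
            rw [hrec, if_neg (by omega)]
            have := iht (by omega)
            have := (ih (m - (t + 1)) (by omega) (by omega)).1 (t + 1) ht
            omega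
        refine ⟨hle, ?_⟩
        obtain ⟨k, rfl⟩ := Nat.exists_eq_succ_of_ne_zero hK.ne'
        rw [Nat.succ_eq_add_one, hrec, if_neg (by omega)]
        have := hle k (by omega)
        have := (ih (m - (k + 1)) (by omega) (by omega)).2
        rw [Nat.succ_eq_add_one] at this
        omega
  have stable : ∀ t j, K ≤ t → j < K → e t j = e K j := by
    intro t j ht hj
    induction t, ht using Nat.le_induction with
    | base => rfl
    | succ t ht iht => rw [hrec, if_pos (by omega), iht, add_zero]
  have pos : ∀ j ∈ range K, 0 ≤ max (e K j) 0 := fun j _ => le_max_right _ _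
  have large : ∀ m, K ≤ m → ∀ t, K ≤ t →
      e t m ≤ -C + ∑ j ∈ range K with m - j ≤ t, max (e K j) 0 := by
    intro m
    induction m using Nat.strong_induction_on with
    | _ m ih =>
      intro hm t ht
      induction t, ht using Nat.le_induction with
      | base =>
        have := (small m hm).2
        have : 0 ≤ ∑ j ∈ range K with m - j ≤ K, max (e K j) 0 :=
          sum_nonneg fun j _ => le_max_right _ _
        omega
      | succ t ht iht =>
        have hmono : ∑ j ∈ range K with m - j ≤ t, max (e K j) 0 ≤
            ∑ j ∈ range K with m - j ≤ t + 1, max (e K j) 0 :=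
          sum_le_sum_of_subset_of_nonneg
            (monotone_filter_right _ fun j _ h => Nat.le_succ_of_le h)
            fun j _ _ => le_max_right _ _
        rw [hrec]
        split_ifs with h
        · omega
        · by_cases hj : m - (t + 1) < K
          · rw [stable _ _ (by omega) hj]
            have hins : insert (m - (t + 1)) {j ∈ range K | m - j ≤ t} ⊆
                {j ∈ range K | m - j ≤ t + 1} := by
              intro j hj'
              simp only [mem_insert, mem_filter, mem_range] at hj' ⊢
              omega
            have h1 := sum_le_sum_of_subset_of_nonneg (f := fun j => max (e K j) 0) hins
              fun j _ _ => le_max_right _ _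
            rw [sum_insert (by simp only [mem_filter, mem_range]; omega)] at h1
            have := le_max_left (e K (m - (t + 1))) 0
            omega
          · have h1 := ih (m - (t + 1)) (by omega) (by omega) (t + 1) (by omega)
            have h2 := sum_le_sum_of_subset_of_nonneg (f := fun j => max (e K j) 0)
              (filter_subset (fun j => m - (t + 1) - j ≤ t + 1) (range K))
              fun j _ _ => le_max_right _ _
            omega
  have h1 := large m hm t ht
  have h2 := sum_le_sum_of_subset_of_nonneg (f := fun j => max (e K j) 0)
    (filter_subset (fun j => m - j ≤ t) (range K)) fun j _ _ => le_max_right _ _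
  omega

/-- Passes the value of `n` to `k`, reducing `n` to a numeral first. -/
def forceNat {α : Type} (n : ℕ) (k : ℕ → α) : α := Nat.rec (k 0) (fun i _ => k (i + 1)) n

theorem forceNat_eq {α : Type} (n : ℕ) (k : ℕ → α) : forceNat n k = k n := by cases n <;> rfl

/-- Passes to its last argument the initial coefficients of `f / (1 - X ^ t)`, where `l` lists
consecutive coefficients of `f` and `q ++ acc.reverse` the `t` coefficients of the quotient that
precede them. The values are reduced to numerals along the way, so that the kernel can evaluate
iterated applications. -/
def divOneSubPow {α : Type} (l : List ℕ) : List ℕ → List ℕ → (List ℕ → α) → α :=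
  List.rec (fun _ _ k => k [])
    (fun x _ ih q acc k =>
      match q with
      | y :: q => forceNat (x + y) fun z => ih q (z :: acc) fun r => k (z :: r)
      | [] =>
        match acc.reverse with
        | y :: q => forceNat (x + y) fun z => ih q [z] fun r => k (z :: r)
        | [] => k []) l

theorem divOneSubPow_eq {α : Type} {f g h : ℕ → ℕ} {t : ℕ} (ht : 0 < t)
    (hg : ∀ i, g i = f i + h i) (hh : ∀ i, h (i + t) = g i) (n b : ℕ) (q acc : List ℕ)
    (k : List ℕ → α) (hq : q ++ acc.reverse = (List.range' b t).map h) :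
    divOneSubPow ((List.range' b n).map f) q acc k = k ((List.range' b n).map g) := by
  obtain ⟨t, rfl⟩ := Nat.exists_eq_succ_of_ne_zero ht.ne'
  have hshift : ∀ b, (List.range' b (t + 1)).map h ++ [g b] =
      h b :: (List.range' (b + 1) (t + 1)).map h := by
    intro b
    rw [← hh, ← List.map_cons, ← List.range'_succ, List.range'_concat (s := b) (n := t + 1)]
    simp
  induction n generalizing b q acc k with
  | zero => rfl
  | succ n ih =>
    rw [List.range'_succ, List.map_cons, List.map_cons]
    have hs := hshift b
    rw [← Nat.succ_eq_add_one, ← hq] at hs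
    cases q with
    | cons y q =>
      simp only [List.cons_append, List.cons.injEq] at hs
      change forceNat (f b + y) (fun z => divOneSubPow _ q (z :: acc) fun r => k (z :: r)) = _
      rw [forceNat_eq, hs.1, ← hg, ih]
      rw [List.reverse_cons, ← List.append_assoc, hs.2]
    | nil =>
      cases hacc : acc.reverse with
      | nil =>
        rw [hacc] at hq
        simp at hq
      | cons y q =>
        rw [hacc] at hs
        simp only [List.nil_append, List.cons_append, List.cons.injEq] at hs
        have : divOneSubPow (f b :: (List.range' (b + 1) n).map f) [] acc k =
            forceNat (f b + y) fun z =>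
              divOneSubPow ((List.range' (b + 1) n).map f) q [z] fun r => k (z :: r) := by
          change (match acc.reverse with
            | y :: q => forceNat (f b + y) fun z =>
                divOneSubPow ((List.range' (b + 1) n).map f) q [z] fun r => k (z :: r)
            | [] => k []) = _
          rw [hacc]
        rw [this, forceNat_eq, hs.1, ← hg, ih]
        rw [List.reverse_singleton, hs.2]

/-- Checks `19 y + C ≤ 21 x` for all consecutive entries `x`, `y` of the list with the given head
and tail `l`. -/
def ratioGapOK (C : ℕ) (l : List ℕ) : ℕ → Bool :=
  List.rec (fun _ => true)
    (fun y _ ih x => Bool.rec false (ih y) (Nat.ble (19 * y + C) (21 * x))) l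

theorem le_of_ratioGapOK {C : ℕ} {f : ℕ → ℕ} {b n : ℕ}
    (h : ratioGapOK C ((List.range' (b + 1) n).map f) (f b) = true) {m : ℕ} (hb : b ≤ m)
    (hm : m < b + n) : 19 * f (m + 1) + C ≤ 21 * f m := by
  induction n generalizing b with
  | zero => omega
  | succ n ih =>
    rw [List.range'_succ, List.map_cons] at h
    change Bool.rec false (ratioGapOK C _ (f (b + 1))) (Nat.ble _ _) = true at h
    cases hle : Nat.ble (19 * f (b + 1) + C) (21 * f b) with
    | false => simp [hle] at h
    | true =>
      rw [hle] at h
      rcases hb.eq_or_lt with rfl | hlt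
      · exact Nat.le_of_ble_eq_true hle
      · exact ih h hlt (by omega)

/-- The sum of `19 y - 21 x` (truncated) over consecutive entries `x`, `y`. -/
def excess : List ℕ → ℕ
  | x :: y :: l => (19 * y - 21 * x) + excess (y :: l)
  | _ => 0

theorem excess_eq {f g : ℕ → ℕ} (hg : ∀ i, g (i + 1) = f i) (n b : ℕ) :
    excess (g b :: (List.range' b n).map f) =
      ∑ i ∈ range n, (19 * f (b + i) - 21 * g (b + i)) := by
  induction n generalizing b with
  | zero => rfl
  | succ n ih =>
    rw [List.range'_succ, List.map_cons, excess, ← hg b, ih, sum_range_succ', add_comm, hg]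
    congr 1
    exact sum_congr rfl fun i _ => by rw [add_right_comm, add_assoc]

/-- Starting from the row `l` of the numbers of partitions of `0, …, 2 K - 1` with parts at most
`t`, checks the bounds needed for `nonpos_of_initial_bounds` in the following rows. -/
def tableOK (K C : ℕ) : ℕ → ℕ → List ℕ → Bool
  | 0, _, l => ratioGapOK C (l.drop K) (l.getD (K - 1) 0) && Nat.ble (excess (0 :: l.take K)) C
  | fuel + 1, t, l =>
    divOneSubPow l (List.replicate (t + 1) 0) [] fun r =>
      ratioGapOK 0 (r.drop K) (r.getD (K - 1) 0) && tableOK K C fuel (t + 1) r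

theorem le_of_ratioGapOK_drop {C K : ℕ} {f : ℕ → ℕ} (hK : 0 < K)
    (h : ratioGapOK C (((List.range' 0 (2 * K)).map f).drop K)
      (((List.range' 0 (2 * K)).map f).getD (K - 1) 0) = true) {m : ℕ} (hKm : K ≤ m)
    (hm : m < 2 * K) : 19 * f m + C ≤ 21 * f (m - 1) := by
  rw [← List.map_drop, List.drop_range', List.getD_eq_getElem _ _ (by simp; omega)] at h
  simp only [List.getElem_map, List.getElem_range'] at h
  have h' := le_of_ratioGapOK (f := f) (b := K - 1) (n := K) (C := C) (m := m - 1)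
    (by convert h using 4 <;> omega) (by omega) (by omega)
  rwa [Nat.sub_add_cancel (by omega)] at h'

theorem bounds_of_tableOK {K C : ℕ} (hK : 0 < K) (fuel t : ℕ)
    (h : tableOK K C fuel t ((List.range' 0 (2 * K)).map (partsLECard t)) = true) :
    (∀ s, t < s → s ≤ t + fuel → ∀ m, K ≤ m → m < 2 * K →
      19 * partsLECard s m ≤ 21 * partsLECard s (m - 1)) ∧
    (∀ m, K ≤ m → m < 2 * K →
      19 * partsLECard (t + fuel) m + C ≤ 21 * partsLECard (t + fuel) (m - 1)) ∧
    ∑ j ∈ range K, (19 * partsLECard (t + fuel) j -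
      21 * if j = 0 then 0 else partsLECard (t + fuel) (j - 1)) ≤ C := by
  induction fuel generalizing t with
  | zero =>
    rw [tableOK, Bool.and_eq_true] at h
    refine ⟨fun s h1 h2 => absurd h1 (by omega),
      fun m h1 h2 => le_of_ratioGapOK_drop hK h.1 h1 h2, ?_⟩
    have h2 := Nat.le_of_ble_eq_true h.2
    rw [← List.map_take, two_mul, ← List.range'_append_1,
      List.take_left' (List.length_range' ..)] at h2
    have h3 := excess_eq (f := partsLECard t)
      (g := fun j => if j = 0 then 0 else partsLECard t (j - 1)) (fun i => by simp) K 0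
    simp only [if_true, zero_add] at h3
    rw [h3] at h2
    exact h2
  | succ fuel ih =>
    rw [tableOK, divOneSubPow_eq (g := partsLECard (t + 1))
      (h := fun m => if m < t + 1 then 0 else partsLECard (t + 1) (m - (t + 1))) t.succ_pos
      (partsLECard_succ t) (fun i => by rw [if_neg (by omega), Nat.add_sub_cancel]),
      Bool.and_eq_true] at h
    · obtain ⟨h1, h2, h3⟩ := ih (t + 1) h.2
      rw [add_right_comm, add_assoc] at h1 h2 h3
      refine ⟨fun s hs hs' m hm hm' => ?_, h2, h3⟩
      rcases (Nat.succ_le_of_lt hs).eq_or_lt with rfl | hlt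
      · exact le_of_ratioGapOK_drop hK h.1 hm hm'
      · exact h1 s hlt hs' m hm hm'
    · rw [List.reverse_nil, List.append_nil, eq_comm, List.eq_replicate_iff]
      refine ⟨by simp, fun x hx => ?_⟩
      obtain ⟨i, hi, rfl⟩ := List.mem_map.1 hx
      rw [List.mem_range'_1] at hi
      exact if_pos (by omega)

theorem tableOK_initial :
    tableOK 163 14538018701 163 0 (1 :: List.replicate 325 0) = true := by
  decide +kernel

theorem nineteen_mul_card_partition_le {m : ℕ} (hm : 163 ≤ m) :
    19 * Fintype.card m.Partition ≤ 21 * Fintype.card (m - 1).Partition := by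
  have hrow : (List.range' 0 (2 * 163)).map (partsLECard 0) = 1 :: List.replicate 325 0 := by
    rw [List.range'_succ, List.map_cons, partsLECard_zero, if_pos rfl, List.cons.injEq,
      List.eq_replicate_iff]
    refine ⟨rfl, by simp, fun x hx => ?_⟩
    obtain ⟨i, hi, rfl⟩ := List.mem_map.1 hx
    rw [List.mem_range'_1] at hi
    rw [partsLECard_zero, if_neg (by omega)]
  obtain ⟨h1, h2, h3⟩ := bounds_of_tableOK (K := 163) (C := 14538018701) (by norm_num) 163 0
    (by rw [hrow]; exact tableOK_initial)
  rw [zero_add] at h1 h2 h3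
  have key := nonpos_of_initial_bounds
    (fun t m => 19 * (partsLECard t m : ℤ) - 21 * if m = 0 then 0 else partsLECard t (m - 1))
    163 14538018701 (by norm_num) ?_ ?_ ?_ ?_ ?_ (t := m) hm hm
  · rw [if_neg (by omega), partsLECard_of_le le_rfl, partsLECard_of_le (Nat.sub_le _ _)] at key
    omega
  · intro t m
    rcases lt_trichotomy m (t + 1) with h | rfl | h
    · have h' : m - 1 < t + 1 := by omega
      simp only [partsLECard_succ t m, partsLECard_succ t (m - 1), if_pos h, if_pos h', add_zero]
    · simp only [lt_self_iff_false, if_false, Nat.sub_self, if_true, Nat.succ_ne_zero,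
        Nat.add_sub_cancel]
      rw [partsLECard_succ t (t + 1), partsLECard_succ t t]
      simp
      ring
    · have h0 : m ≠ 0 := by omega
      have h1 : ¬ m < t + 1 := by omega
      have h2 : ¬ m - 1 < t + 1 := by omega
      have h3 : m - (t + 1) ≠ 0 := by omega
      simp only [partsLECard_succ t m, partsLECard_succ t (m - 1), h0, h1, h2, h3, if_false]
      rw [show m - 1 - (t + 1) = m - (t + 1) - 1 by omega]
      push_cast
      ring
  · intro m hm
    simp only [partsLECard_zero]
    rw [if_neg (by omega), if_neg (by omega), if_neg (by omega)]
    norm_num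
  · intro t m ht hm hm'
    rw [if_neg (by omega)]
    rcases t.eq_zero_or_pos with rfl | h0
    · simp only [partsLECard_zero]
      rw [if_neg (by omega), if_neg (by omega)]
      norm_num
    · have := h1 t h0 ht m hm hm'
      omega
  · intro m hm hm'
    rw [if_neg (by omega)]
    have := h2 m hm hm'
    omega
  · refine le_trans (le_of_eq ?_) (Nat.cast_le.2 h3)
    rw [Nat.cast_sum]
    refine sum_congr rfl fun j _ => ?_
    split_ifs <;> omega

end partitionCounts

/-- The order relation between earlier and later entries of an increasing list whose odd entries
are distinct and precede its even entries. -/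
def OddFirst (x y : ℕ) : Prop := x ≤ y ∧ (Odd x → Odd y → x ≠ y) ∧ (Odd y → Odd x)

theorem countP_odd_eq_zero_of_even_cons {x : ℕ} {l : List ℕ} (hl : (x :: l).Pairwise OddFirst)
    (hx : ¬ Odd x) : (x :: l).countP (Odd ·) = 0 := by
  rw [List.countP_eq_zero]
  intro y hy
  rcases List.mem_cons.1 hy with rfl | hy
  · simpa using hx
  · simpa using fun h => hx (((List.pairwise_cons.1 hl).1 y hy).2.2 h)

theorem add_two_le_of_oddFirst {x y : ℕ} (h : OddFirst x y) (hx : Odd x) (hy : Odd y) :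
    x + 2 ≤ y := by
  have h1 := h.1
  have h2 := h.2.1 hx hy
  obtain ⟨a, rfl⟩ := hx
  obtain ⟨b, rfl⟩ := hy
  omega

theorem le_even_of_odd_cons {x : ℕ} {l : List ℕ} (hl : (x :: l).Pairwise OddFirst) (hx : Odd x)
    {y : ℕ} (hy : y ∈ l) (hye : ¬ Odd y) : x + 2 * l.countP (Odd ·) + 1 ≤ y := by
  induction l generalizing x with
  | nil => simp at hy
  | cons w l ih =>
    obtain ⟨hxw, hl⟩ := List.pairwise_cons.1 hl
    by_cases hw : Odd w
    · have h1 := add_two_le_of_oddFirst (hxw w List.mem_cons_self) hx hw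
      rcases List.mem_cons.1 hy with rfl | hy
      · exact absurd hw hye
      · have := ih hl hw hy
        rw [List.countP_cons_of_pos (by simpa using hw)]
        omega
    · rw [countP_odd_eq_zero_of_even_cons hl hw]
      have h1 := (hxw y hy).1
      have h2 : x ≠ y := fun h => hye (h ▸ hx)
      omega

/-- Halves the entries of a list, rounding up, and adds `s - j` to the `j`-th odd entry, counting
from `j = i`. -/
def halve (s : ℕ) : ℕ → List ℕ → List ℕ
  | _, [] => []
  | i, x :: l => if Odd x then ((x + 1) / 2 + s - i) :: halve s (i + 1) l else x / 2 :: halve s i l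

section halve

variable {s i : ℕ} {l : List ℕ}

theorem odd_bound_tail {x : ℕ} (hl : (x :: l).Pairwise OddFirst) (hx : Odd x)
    (hi : ∀ y ∈ x :: l, Odd y → 2 * i + 1 ≤ y) : ∀ y ∈ l, Odd y → 2 * (i + 1) + 1 ≤ y := by
  intro y hy hyo
  have h1 := add_two_le_of_oddFirst ((List.pairwise_cons.1 hl).1 y hy) hx hyo
  have h2 := hi x List.mem_cons_self hx
  omega

theorem sum_halve (hl : l.Pairwise OddFirst) (hi : ∀ y ∈ l, Odd y → 2 * i + 1 ≤ y) :
    2 * (halve s i l).sum + 2 * i * l.countP (Odd ·) + l.countP (Odd ·) ^ 2 =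
      l.sum + 2 * l.countP (Odd ·) + 2 * s * l.countP (Odd ·) := by
  induction l generalizing i with
  | nil => simp [halve]
  | cons x l ih =>
    by_cases hx : Odd x
    · have := ih (List.pairwise_cons.1 hl).2 (odd_bound_tail hl hx hi)
      have hix := hi x List.mem_cons_self hx
      rw [halve, if_pos hx, List.sum_cons, List.sum_cons,
        List.countP_cons_of_pos (by simpa using hx)]
      obtain ⟨j, rfl⟩ := hx
      obtain ⟨d, rfl⟩ := Nat.exists_eq_add_of_le (show i ≤ j by omega)
      rw [show (2 * (i + d) + 1 + 1) / 2 + s - i = d + 1 + s by omega]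
      linarith
    · have := ih (List.pairwise_cons.1 hl).2 fun y hy => hi y (List.mem_cons_of_mem _ hy)
      rw [halve, if_neg hx, List.sum_cons, List.sum_cons,
        List.countP_cons_of_neg (by simpa using hx)]
      have hx' : 2 * (x / 2) = x := Nat.two_mul_div_two_of_even (Nat.not_odd_iff_even.1 hx)
      linarith

theorem le_of_mem_halve {v : ℕ} (hl : l.Pairwise OddFirst)
    (ho : ∀ y ∈ l, Odd y → 2 * (v + i) ≤ y + 1 + 2 * s) (he : ∀ y ∈ l, ¬ Odd y → 2 * v ≤ y) :
    ∀ z ∈ halve s i l, v ≤ z := by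
  induction l generalizing i with
  | nil => simp [halve]
  | cons x l ih =>
    obtain ⟨hxl, hl'⟩ := List.pairwise_cons.1 hl
    have he' : ∀ y ∈ l, ¬ Odd y → 2 * v ≤ y := fun y hy => he y (List.mem_cons_of_mem _ hy)
    by_cases hx : Odd x
    · rw [halve, if_pos hx]
      have hx' := ho x List.mem_cons_self hx
      refine List.forall_mem_cons.2 ⟨by obtain ⟨j, rfl⟩ := hx; omega, ih hl' ?_ he'⟩
      intro y hy hyo
      have := add_two_le_of_oddFirst (hxl y hy) hx hyo
      omega
    · rw [halve, if_neg hx]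
      have hx' := he x List.mem_cons_self hx
      exact List.forall_mem_cons.2
        ⟨by omega, ih hl' (fun y hy => ho y (List.mem_cons_of_mem _ hy)) he'⟩

theorem pairwise_halve (hl : l.Pairwise OddFirst) (hi : ∀ y ∈ l, Odd y → 2 * i + 1 ≤ y)
    (hs : l.countP (Odd ·) ≠ 0 → s + 1 ≤ i + l.countP (Odd ·)) :
    (halve s i l).Pairwise (· ≤ ·) := by
  induction l generalizing i with
  | nil => simp [halve]
  | cons x l ih =>
    obtain ⟨hxl, hl'⟩ := List.pairwise_cons.1 hl
    by_cases hx : Odd x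
    · rw [List.countP_cons_of_pos (by simpa using hx)] at hs
      have hix := hi x List.mem_cons_self hx
      have hs' := hs (by omega)
      rw [halve, if_pos hx]
      refine List.pairwise_cons.2
        ⟨le_of_mem_halve hl' ?_ ?_, ih hl' (odd_bound_tail hl hx hi) fun _ => by omega⟩
      · intro y hy hyo
        have := add_two_le_of_oddFirst (hxl y hy) hx hyo
        omega
      · intro y hy hye
        have := le_even_of_odd_cons hl hx hy hye
        omega
    · have h0 := countP_odd_eq_zero_of_even_cons hl hx
      rw [List.countP_cons_of_neg (by simpa using hx)] at h0
      rw [halve, if_neg hx]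
      refine List.pairwise_cons.2
        ⟨le_of_mem_halve hl' ?_ ?_, ih hl' (fun y hy => hi y (List.mem_cons_of_mem _ hy))
          fun h => absurd h0 h⟩
      · exact fun y hy hyo => absurd ((hxl y hy).2.2 hyo) hx
      · intro y hy _
        have := (hxl y hy).1
        omega

theorem halve_injective {l' : List ℕ} (hl : l.Pairwise OddFirst) (hl' : l'.Pairwise OddFirst)
    (hi : ∀ y ∈ l, Odd y → 2 * i + 1 ≤ y) (hi' : ∀ y ∈ l', Odd y → 2 * i + 1 ≤ y)
    (hc : l.countP (Odd ·) = l'.countP (Odd ·)) (h : halve s i l = halve s i l') : l = l' := by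
  induction l generalizing i l' with
  | nil =>
    cases l' with
    | nil => rfl
    | cons x' l' => rw [halve, halve] at h; split_ifs at h
  | cons x l ih =>
    cases l' with
    | nil => rw [halve, halve] at h; split_ifs at h
    | cons x' l' =>
      rw [halve, halve] at h
      have hp := (List.pairwise_cons.1 hl).2
      have hp' := (List.pairwise_cons.1 hl').2
      by_cases hx : Odd x <;> by_cases hx' : Odd x'
      · rw [if_pos hx, if_pos hx', List.cons.injEq] at h
        rw [List.countP_cons_of_pos (by simpa using hx),
          List.countP_cons_of_pos (by simpa using hx')] at hc
        rw [ih hp hp' (odd_bound_tail hl hx hi) (odd_bound_tail hl' hx' hi') (by omega) h.2]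
        have h1 := hi x List.mem_cons_self hx
        have h2 := hi' x' List.mem_cons_self hx'
        obtain ⟨a, rfl⟩ := hx
        obtain ⟨b, rfl⟩ := hx'
        rw [show a = b by omega]
      · rw [countP_odd_eq_zero_of_even_cons hl' hx',
          List.countP_cons_of_pos (by simpa using hx)] at hc
        omega
      · rw [countP_odd_eq_zero_of_even_cons hl hx,
          List.countP_cons_of_pos (by simpa using hx')] at hc
        omega
      · rw [if_neg hx, if_neg hx', List.cons.injEq] at h
        rw [List.countP_cons_of_neg (by simpa using hx),
          List.countP_cons_of_neg (by simpa using hx')] at hc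
        rw [ih hp hp' (fun y hy => hi y (List.mem_cons_of_mem _ hy))
          (fun y hy => hi' y (List.mem_cons_of_mem _ hy)) hc h.2]
        rw [Nat.not_odd_iff_even] at hx hx'
        obtain ⟨a, rfl⟩ := hx
        obtain ⟨b, rfl⟩ := hx'
        rw [show a = b by omega]

end halve

/-- Doubles the entries of a list padded with zeros to length at least `k`, and adds
`2 k - 1, …, 3, 1` to the first `k` of them. -/
def doubleAddOdd : ℕ → List ℕ → List ℕ
  | 0, l => l.map (2 * ·)
  | k + 1, [] => (2 * k + 1) :: doubleAddOdd k []
  | k + 1, x :: l => (2 * x + 2 * k + 1) :: doubleAddOdd k l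

theorem sum_doubleAddOdd (k : ℕ) (l : List ℕ) : (doubleAddOdd k l).sum = k ^ 2 + 2 * l.sum := by
  induction k generalizing l with
  | zero => simpa [doubleAddOdd] using List.sum_map_mul_left l id 2
  | succ k ih => cases l <;> simp only [doubleAddOdd, List.sum_cons, ih, List.sum_nil] <;> ring

theorem countP_odd_doubleAddOdd (k : ℕ) (l : List ℕ) :
    (doubleAddOdd k l).countP (Odd ·) = k := by
  induction k generalizing l with
  | zero => simp [doubleAddOdd, List.countP_eq_zero]
  | succ k ih =>
    cases l <;> rw [doubleAddOdd, List.countP_cons_of_pos, ih] <;> simp [parity_simps]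

theorem pos_of_mem_doubleAddOdd (k : ℕ) (l : List ℕ) (hl : ∀ x ∈ l, 0 < x) :
    ∀ z ∈ doubleAddOdd k l, 0 < z := by
  induction k generalizing l with
  | zero => simpa [doubleAddOdd] using hl
  | succ k ih =>
    cases l with
    | nil => exact List.forall_mem_cons.2 ⟨by omega, ih [] hl⟩
    | cons x l => exact List.forall_mem_cons.2 ⟨by omega, ih l (List.forall_mem_cons.1 hl).2⟩

theorem le_of_mem_doubleAddOdd {v : ℕ} (k : ℕ) (l : List ℕ) (hl : ∀ x ∈ l, x ≤ v) :
    ∀ z ∈ doubleAddOdd k l, z ≤ 2 * v + 2 * k := by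
  induction k generalizing l with
  | zero => simpa [doubleAddOdd] using hl
  | succ k ih =>
    cases l with
    | nil =>
      exact List.forall_mem_cons.2 ⟨by omega, fun z hz => (ih [] hl z hz).trans (by omega)⟩
    | cons x l =>
      obtain ⟨hx, hl⟩ := List.forall_mem_cons.1 hl
      exact List.forall_mem_cons.2 ⟨by omega, fun z hz => (ih l hl z hz).trans (by omega)⟩

theorem pairwise_doubleAddOdd (k : ℕ) (l : List ℕ) (hl : l.Pairwise (· ≥ ·)) :
    (doubleAddOdd k l).Pairwise fun x y => y ≤ x ∧ (Odd y → Odd x ∧ y < x) := by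
  induction k generalizing l with
  | zero =>
    rw [doubleAddOdd, List.pairwise_map]
    exact hl.imp fun h => ⟨by omega, fun ho => absurd ho (by simp)⟩
  | succ k ih =>
    cases l with
    | nil =>
      refine List.pairwise_cons.2 ⟨fun z hz => ?_, ih [] hl⟩
      have := le_of_mem_doubleAddOdd (v := 0) k [] (by simp) z hz
      exact ⟨by omega, fun _ => ⟨⟨k, rfl⟩, by omega⟩⟩
    | cons x l =>
      obtain ⟨hx, hl⟩ := List.pairwise_cons.1 hl
      refine List.pairwise_cons.2 ⟨fun z hz => ?_, ih l hl⟩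
      have := le_of_mem_doubleAddOdd k l hx z hz
      exact ⟨by omega, fun _ => ⟨⟨x + k, by ring⟩, by omega⟩⟩

theorem doubleAddOdd_injective (k : ℕ) {l l' : List ℕ} (hl : ∀ x ∈ l, 0 < x)
    (hl' : ∀ x ∈ l', 0 < x) (h : doubleAddOdd k l = doubleAddOdd k l') : l = l' := by
  induction k generalizing l l' with
  | zero => exact List.map_injective_iff.2 (fun a b => by simp) h
  | succ k ih =>
    cases l <;> cases l' <;> simp only [doubleAddOdd, List.cons.injEq] at h
    · rfl
    · have := hl' _ List.mem_cons_self
      omega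
    · have := hl _ List.mem_cons_self
      omega
    · rw [ih (List.forall_mem_cons.1 hl).2 (List.forall_mem_cons.1 hl').2 h.2]
      congr 1
      omega

theorem two_mul_countP_odd_le {l : List ℕ} (hl : l.Pairwise OddFirst) {y : ℕ} (hy : y ∈ l)
    (hye : ¬ Odd y) : 2 * l.countP (Odd ·) ≤ y := by
  cases l with
  | nil => simp at hy
  | cons x l =>
    by_cases hx : Odd x
    · rcases List.mem_cons.1 hy with rfl | hy
      · exact absurd hx hye
      · have := le_even_of_odd_cons hl hx hy hye
        have := hx.pos
        rw [List.countP_cons_of_pos (by simpa using hx)]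
        omega
    · rw [countP_odd_eq_zero_of_even_cons hl hx]
      omega

theorem EvenGtOddDistinct.pairwise_sort {M : Multiset ℕ} (h : EvenGtOddDistinct M) :
    (M.sort (· ≤ ·)).Pairwise OddFirst := by
  have h1 := h.1
  rw [← M.sort_eq (· ≤ ·), Multiset.filter_coe, Multiset.coe_nodup, List.Nodup,
    List.pairwise_filter] at h1
  refine (h1.and (M.pairwise_sort (· ≤ ·))).imp_of_mem fun {x y} hx hy hxy => ?_
  refine ⟨hxy.2, fun hxo hyo => hxy.1 (by simpa using hxo) (by simpa using hyo), fun hyo => ?_⟩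
  by_contra hxe
  have := h.2 x (by simpa using hx) (Nat.not_odd_iff_even.1 hxe) y (by simpa using hy) hyo
  have := hxy.2
  omega

theorem countP_sort (M : Multiset ℕ) :
    (M.sort (· ≤ ·)).countP (Odd ·) = M.countP (Odd ·) := by
  conv_rhs => rw [← M.sort_eq (· ≤ ·), Multiset.coe_countP]

theorem oddDistinctGtEven_coe {l : List ℕ}
    (hl : l.Pairwise fun x y => y ≤ x ∧ (Odd y → Odd x ∧ y < x)) : OddDistinctGtEven ↑l := by
  constructor
  · rw [Multiset.filter_coe, Multiset.coe_nodup, List.Nodup, List.pairwise_filter]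
    exact hl.imp fun h _ hy => (h.2 (by simpa using hy)).2.ne'
  · let R : ℕ → ℕ → Prop := fun x y => (Odd x → Even y → y < x) ∧ (Odd y → Even x → x < y)
    have : Std.Symm R := ⟨fun _ _ h => ⟨h.2, h.1⟩⟩
    have hR : l.Pairwise R := by
      refine hl.imp fun {x y} h => ⟨fun hx hy => lt_of_le_of_ne h.1 ?_, fun hy hx => ?_⟩
      · rintro rfl
        exact Nat.not_even_iff_odd.2 hx hy
      · exact absurd hx (Nat.not_even_iff_odd.2 (h.2 hy).1)
    intro o ho hoo e he hee
    exact (hR.forall_of_forall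
      (fun x _ => ⟨fun h h' => absurd h' (Nat.not_even_iff_odd.2 h),
        fun h h' => absurd h' (Nat.not_even_iff_odd.2 h)⟩) ho he).1 hoo hee

open Classical in
/-- The partitions of `n` with `k` odd parts, which are distinct and smaller than all even parts. -/
noncomputable def evenGtParts (n k : ℕ) : Finset n.Partition :=
  {p | EvenGtOddDistinct p.parts ∧ p.parts.countP (Odd ·) = k}

open Classical in
/-- The partitions of `n` with `k` odd parts, which are distinct and greater than all even parts. -/
noncomputable def oddGtParts (n k : ℕ) : Finset n.Partition :=
  {p | OddDistinctGtEven p.parts ∧ p.parts.countP (Odd ·) = k}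

section evenGt

variable {n k : ℕ}

theorem mem_evenGtParts {p : n.Partition} :
    p ∈ evenGtParts n k ↔ EvenGtOddDistinct p.parts ∧ p.parts.countP (Odd ·) = k := by
  simp [evenGtParts]

theorem mem_oddGtParts {p : n.Partition} :
    p ∈ oddGtParts n k ↔ OddDistinctGtEven p.parts ∧ p.parts.countP (Odd ·) = k := by
  simp [oddGtParts]

theorem one_le_of_mem_sort (p : n.Partition) :
    ∀ y ∈ p.parts.sort (· ≤ ·), Odd y → 2 * 0 + 1 ≤ y :=
  fun _ _ hyo => hyo.pos

theorem sum_halve_sort {p : n.Partition} (hp : p ∈ evenGtParts n k) (s : ℕ) :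
    2 * (halve s 0 (p.parts.sort (· ≤ ·))).sum + k ^ 2 = n + 2 * k + 2 * s * k := by
  rw [mem_evenGtParts] at hp
  have := sum_halve (s := s) hp.1.pairwise_sort (one_le_of_mem_sort p)
  rw [countP_sort, hp.2, ← Multiset.sum_coe (p.parts.sort (· ≤ ·)), Multiset.sort_eq,
    p.parts_sum] at this
  linarith

theorem le_of_mem_halve_sort {p : n.Partition} (hp : p ∈ evenGtParts n k) {s : ℕ}
    (hs : s ≤ k - 1) : ∀ z ∈ halve s 0 (p.parts.sort (· ≤ ·)), s + 1 ≤ z := by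
  rw [mem_evenGtParts] at hp
  refine le_of_mem_halve hp.1.pairwise_sort (fun y _ hyo => ?_) fun y hy hye => ?_
  · have := hyo.pos
    omega
  · have := two_mul_countP_odd_le hp.1.pairwise_sort hy hye
    rw [countP_sort, hp.2] at this
    have := p.parts_pos (by simpa using hy)
    have : y ≠ 1 := by rintro rfl; simp at hye
    omega

theorem card_evenGtParts_le {m s : ℕ} (hs : s ≤ k - 1)
    (hm : 2 * m + k ^ 2 = n + 2 * k + 2 * s * k) :
    (evenGtParts n k).card ≤ (Nat.Partition.restricted m (s + 1 ≤ ·)).card := by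
  refine Finset.card_le_card_of_injOn
    (fun p => if hp : p ∈ evenGtParts n k then
      { parts := ↑(halve s 0 (p.parts.sort (· ≤ ·)))
        parts_pos := fun {z} hz => (Nat.succ_pos s).trans_le (le_of_mem_halve_sort hp hs z hz)
        parts_sum := by
          have := sum_halve_sort hp s
          rw [Multiset.sum_coe]
          omega }
      else Nat.Partition.indiscrete m) (fun p hp => ?_) fun p hp p' hp' h => ?_
  · rw [Finset.mem_coe] at hp
    simp only [dif_pos hp, Finset.mem_coe, Nat.Partition.restricted, Finset.mem_filter,
      Finset.mem_univ, true_and]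
    exact le_of_mem_halve_sort hp hs
  · rw [Finset.mem_coe] at hp hp'
    simp only [dif_pos hp, dif_pos hp', Nat.Partition.mk.injEq, Multiset.coe_eq_coe] at h
    rw [mem_evenGtParts] at hp hp'
    have hc (q : n.Partition) (hq : q.parts.countP (Odd ·) = k) :
        (q.parts.sort (· ≤ ·)).countP (Odd ·) ≠ 0 →
          s + 1 ≤ 0 + (q.parts.sort (· ≤ ·)).countP (Odd ·) := by
      rw [countP_sort, hq]
      omega
    have h := h.eq_of_pairwise (fun a b _ _ => le_antisymm)
      (pairwise_halve hp.1.pairwise_sort (one_le_of_mem_sort p) (hc p hp.2))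
      (pairwise_halve hp'.1.pairwise_sort (one_le_of_mem_sort p') (hc p' hp'.2))
    have := halve_injective hp.1.pairwise_sort hp'.1.pairwise_sort (one_le_of_mem_sort p)
      (one_le_of_mem_sort p') (by rw [countP_sort, countP_sort, hp.2, hp'.2]) h
    rw [Nat.Partition.ext_iff, ← p.parts.sort_eq (· ≤ ·), this, Multiset.sort_eq]

theorem card_evenGtParts_le_card {m : ℕ} (hm : 2 * m + k ^ 2 = n + 2 * k) :
    (evenGtParts n k).card ≤ Fintype.card m.Partition :=
  (card_evenGtParts_le (s := 0) (Nat.zero_le _) (by omega)).trans (Finset.card_le_univ _)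

theorem card_evenGtParts_add_card_le {m : ℕ} (hk : 2 ≤ k) (hm : 2 * (m + 1) = n + k ^ 2) :
    (evenGtParts n k).card + Fintype.card m.Partition ≤ Fintype.card (m + 1).Partition := by
  rw [← card_restricted_ne_one_add m]
  gcongr
  obtain ⟨s, rfl⟩ := Nat.exists_eq_add_of_le' hk
  refine (card_evenGtParts_le (m := m + 1) (s := s + 1) (by omega)
    (by rw [hm]; ring)).trans (Finset.card_le_card fun p => ?_)
  simp only [Nat.Partition.restricted, Finset.mem_filter, Finset.mem_univ, true_and]
  exact fun h z hz => by have := h z hz; omega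

theorem exists_two_mul_add_sq (h : evenGtParts n k ≠ ∅) : ∃ m, 2 * m + k ^ 2 = n + 2 * k := by
  obtain ⟨p, hp⟩ := Finset.nonempty_iff_ne_empty.2 h
  exact ⟨_, by simpa using sum_halve_sort hp 0⟩

theorem card_partition_le_card_oddGtParts {m : ℕ} (hm : n = k ^ 2 + 2 * m) :
    Fintype.card m.Partition ≤ (oddGtParts n k).card := by
  rw [← Finset.card_univ]
  have hpos (p : m.Partition) : ∀ x ∈ p.parts.sort (· ≥ ·), 0 < x :=
    fun x hx => p.parts_pos (by simpa using hx)
  refine Finset.card_le_card_of_injOn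
    (fun p =>
      { parts := ↑(doubleAddOdd k (p.parts.sort (· ≥ ·)))
        parts_pos := fun {z} hz => pos_of_mem_doubleAddOdd k _ (hpos p) z hz
        parts_sum := by
          rw [Multiset.sum_coe, sum_doubleAddOdd, ← Multiset.sum_coe, Multiset.sort_eq,
            p.parts_sum, hm] }) (fun p _ => ?_) fun p _ p' _ h => ?_
  · rw [Finset.mem_coe, mem_oddGtParts]
    exact ⟨oddDistinctGtEven_coe (pairwise_doubleAddOdd k _ (Multiset.pairwise_sort _ _)),
      by rw [Multiset.coe_countP, countP_odd_doubleAddOdd]⟩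
  · simp only [Nat.Partition.mk.injEq, Multiset.coe_eq_coe] at h
    have h := h.eq_of_pairwise (fun a b _ _ h h' => le_antisymm h'.1 h.1)
      (pairwise_doubleAddOdd k _ (Multiset.pairwise_sort _ _))
      (pairwise_doubleAddOdd k _ (Multiset.pairwise_sort _ _))
    have := doubleAddOdd_injective k (hpos p) (hpos p') h
    rw [Nat.Partition.ext_iff, ← p.parts.sort_eq (· ≥ ·), this, Multiset.sort_eq]

end evenGt

theorem countP_odd_parts_le {n : ℕ} (p : n.Partition) : p.parts.countP (Odd ·) ≤ n := by
  refine (Multiset.countP_le_card _ _).trans ?_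
  have := Multiset.card_nsmul_le_sum (s := p.parts) (a := 1) fun x hx => p.parts_pos hx
  simpa [p.parts_sum] using this

theorem podeu_eq_sum (n : ℕ) {M : ℕ} (hM : n < M) :
    podeu n = ∑ k ∈ Finset.range M, (evenGtParts n k).card := by
  classical
  rw [podeu, Nat.card_eq_fintype_card, Fintype.card_subtype,
    Finset.card_eq_sum_card_fiberwise (f := fun p => p.parts.countP (Odd ·))
      (t := Finset.range M)
      fun p _ => by simpa using (countP_odd_parts_le p).trans_lt hM]
  refine Finset.sum_congr rfl fun k _ => congrArg _ ?_
  ext p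
  simp [mem_evenGtParts]

theorem peuod_eq_sum (n : ℕ) {M : ℕ} (hM : n < M) :
    peuod n = ∑ k ∈ Finset.range M, (oddGtParts n k).card := by
  classical
  rw [peuod, Nat.card_eq_fintype_card, Fintype.card_subtype,
    Finset.card_eq_sum_card_fiberwise (f := fun p => p.parts.countP (Odd ·))
      (t := Finset.range M)
      fun p _ => by simpa using (countP_odd_parts_le p).trans_lt hM]
  refine Finset.sum_congr rfl fun k _ => congrArg _ ?_
  ext p
  simp [mem_oddGtParts]

theorem card_evenGtParts_eq_zero {n k : ℕ} (h : ¬ (k ≡ n [MOD 2])) :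
    (evenGtParts n k).card = 0 := by
  rw [Finset.card_eq_zero]
  by_contra hne
  obtain ⟨m, hm⟩ := exists_two_mul_add_sq hne
  have h1 : k ^ 2 % 2 = k % 2 := by
    rcases Nat.mod_two_eq_zero_or_one k with h | h <;> simp [Nat.pow_mod, h]
  exact h (by unfold Nat.ModEq; omega)

theorem card_evenGtParts_le_card_oddGtParts (n k : ℕ) :
    (evenGtParts n (k + 6)).card ≤ (oddGtParts n (k + 4)).card := by
  by_cases hne : evenGtParts n (k + 6) = ∅
  · simp [hne]
  obtain ⟨m, hm⟩ := exists_two_mul_add_sq hne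
  calc (evenGtParts n (k + 6)).card ≤ Fintype.card m.Partition := card_evenGtParts_le_card hm
    _ ≤ Fintype.card (m + k + 4).Partition := card_partition_mono (by omega)
    _ ≤ (oddGtParts n (k + 4)).card := card_partition_le_card_oddGtParts (by linarith)

theorem card_partition_pos (m : ℕ) : 0 < Fintype.card m.Partition :=
  Fintype.card_pos

theorem sum_evenGtParts_lt_of_odd {N : ℕ} (hN : 167 ≤ N) :
    ∑ k ∈ Finset.range 6, (evenGtParts (2 * N + 1) k).card <
      ∑ k ∈ Finset.range 4, (oddGtParts (2 * N + 1) k).card := by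
  obtain ⟨M, rfl⟩ := Nat.exists_eq_add_of_le' (show 4 ≤ N by omega)
  have h0 (k : ℕ) (hk : k % 2 = 0) : (evenGtParts (2 * (M + 4) + 1) k).card = 0 :=
    card_evenGtParts_eq_zero (by unfold Nat.ModEq; omega)
  have hr (i j : ℕ) (hij : i + 1 = j) : 19 * Fintype.card (M + j).Partition ≤
      21 * Fintype.card (M + i).Partition := by
    rw [← hij]
    exact nineteen_mul_card_partition_le (m := M + (i + 1)) (by omega)
  have g1 : (evenGtParts (2 * (M + 4) + 1) 1).card ≤ Fintype.card (M + 5).Partition :=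
    card_evenGtParts_le_card (by omega)
  have g3 : (evenGtParts (2 * (M + 4) + 1) 3).card + Fintype.card (M + 8).Partition ≤
      Fintype.card (M + 9).Partition := card_evenGtParts_add_card_le (by omega) (by omega)
  have g5 : (evenGtParts (2 * (M + 4) + 1) 5).card + Fintype.card (M + 16).Partition ≤
      Fintype.card (M + 17).Partition := card_evenGtParts_add_card_le (by omega) (by omega)
  have f1 : Fintype.card (M + 4).Partition ≤ (oddGtParts (2 * (M + 4) + 1) 1).card :=
    card_partition_le_card_oddGtParts (by omega)
  have f3 : Fintype.card (M + 0).Partition ≤ (oddGtParts (2 * (M + 4) + 1) 3).card :=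
    card_partition_le_card_oddGtParts (by omega)
  simp only [Finset.sum_range_succ, Finset.sum_range_zero, h0 0 rfl, h0 2 rfl, h0 4 rfl]
  linarith [card_partition_pos (M + 0), hr 0 1 rfl, hr 1 2 rfl, hr 2 3 rfl, hr 3 4 rfl,
    hr 4 5 rfl, hr 5 6 rfl, hr 6 7 rfl, hr 7 8 rfl, hr 8 9 rfl, hr 9 10 rfl, hr 10 11 rfl,
    hr 11 12 rfl, hr 12 13 rfl, hr 13 14 rfl, hr 14 15 rfl, hr 15 16 rfl, hr 16 17 rfl]

theorem sum_evenGtParts_lt_of_even {N : ℕ} (hN : 165 ≤ N) :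
    ∑ k ∈ Finset.range 6, (evenGtParts (2 * N) k).card <
      ∑ k ∈ Finset.range 4, (oddGtParts (2 * N) k).card := by
  obtain ⟨M, rfl⟩ := Nat.exists_eq_add_of_le' (show 2 ≤ N by omega)
  have h0 (k : ℕ) (hk : k % 2 = 1) : (evenGtParts (2 * (M + 2)) k).card = 0 :=
    card_evenGtParts_eq_zero (by unfold Nat.ModEq; omega)
  have hr (i j : ℕ) (hij : i + 1 = j) : 19 * Fintype.card (M + j).Partition ≤
      21 * Fintype.card (M + i).Partition := by
    rw [← hij]
    exact nineteen_mul_card_partition_le (m := M + (i + 1)) (by omega)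
  have g0 : (evenGtParts (2 * (M + 2)) 0).card ≤ Fintype.card (M + 2).Partition :=
    card_evenGtParts_le_card (by omega)
  have g2 : (evenGtParts (2 * (M + 2)) 2).card + Fintype.card (M + 3).Partition ≤
      Fintype.card (M + 4).Partition := card_evenGtParts_add_card_le (by omega) (by omega)
  have g4 : (evenGtParts (2 * (M + 2)) 4).card + Fintype.card (M + 9).Partition ≤
      Fintype.card (M + 10).Partition := card_evenGtParts_add_card_le (by omega) (by omega)
  have f0 : Fintype.card (M + 2).Partition ≤ (oddGtParts (2 * (M + 2)) 0).card :=
    card_partition_le_card_oddGtParts (by omega)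
  have f2 : Fintype.card (M + 0).Partition ≤ (oddGtParts (2 * (M + 2)) 2).card :=
    card_partition_le_card_oddGtParts (by omega)
  simp only [Finset.sum_range_succ, Finset.sum_range_zero, h0 1 rfl, h0 3 rfl, h0 5 rfl]
  linarith [card_partition_pos (M + 0), hr 0 1 rfl, hr 1 2 rfl, hr 2 3 rfl, hr 3 4 rfl,
    hr 4 5 rfl, hr 5 6 rfl, hr 6 7 rfl, hr 7 8 rfl, hr 8 9 rfl, hr 9 10 rfl]

theorem podeu_lt_peuod {n : ℕ} (hn : 335 ≤ n) : podeu n < peuod n := by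
  rw [podeu_eq_sum n (M := 6 + n) (by omega), peuod_eq_sum n (M := 4 + n) (by omega),
    Finset.sum_range_add, Finset.sum_range_add]
  refine add_lt_add_of_lt_of_le ?_ (Finset.sum_le_sum fun k _ => ?_)
  · rcases Nat.even_or_odd' n with ⟨N, rfl | rfl⟩
    · exact sum_evenGtParts_lt_of_even (by omega)
    · exact sum_evenGtParts_lt_of_odd (by omega)
  · rw [add_comm 6, add_comm 4]
    exact card_evenGtParts_le_card_oddGtParts n k

theorem exists_injective_notMem_range {α β : Type*} [Finite α] [Finite β]
    (h : Nat.card α < Nat.card β) (q : β) :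
    ∃ f : α → β, Function.Injective f ∧ q ∉ Set.range f := by
  classical
  have := Fintype.ofFinite α
  have := Fintype.ofFinite β
  rw [Nat.card_eq_fintype_card, Nat.card_eq_fintype_card] at h
  obtain ⟨g⟩ := Function.Embedding.nonempty_of_card_le h.le
  obtain ⟨y, hy⟩ : ∃ y, ∀ a, g a ≠ y := by
    by_contra! hs
    exact absurd (Fintype.card_le_of_surjective g hs) h.not_ge
  refine ⟨Equiv.swap y q ∘ g, (Equiv.injective _).comp g.injective, ?_⟩
  rintro ⟨a, ha⟩
  exact hy a (by simpa [Equiv.swap_apply_eq_iff] using ha)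

theorem oddDistinctGtEven_of_odd {k j : ℕ} (hk : 10 ≤ k) (hj : j ∈ ({1, 3, 5} : Finset ℕ)) :
    OddDistinctGtEven {2 * k + 3, 2 * k + 1, 2 * k + j - 8, 2, 2} := by
  obtain ⟨i, hi, rfl⟩ : ∃ i ≤ 2, j = 2 * i + 1 := by
    fin_cases hj
    exacts [⟨0, by simp⟩, ⟨1, by simp⟩, ⟨2, by simp⟩]
  have h : ({2 * k + 3, 2 * k + 1, 2 * k + (2 * i + 1) - 8, 2, 2} : Multiset ℕ) =
    ↑[2 * (k + 1) + 1, 2 * k + 1, 2 * (k + i - 4) + 1, 2 * 1, 2 * 1] := by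
    rw [show 2 * k + (2 * i + 1) - 8 = 2 * (k + i - 4) + 1 by omega]
    rfl
  rw [h]
  apply oddDistinctGtEven_coe
  simp [parity_simps]
  omega

theorem oddDistinctGtEven_of_even {k j : ℕ} (hk : 10 ≤ k) (hj : j ∈ ({0, 2, 4} : Finset ℕ)) :
    OddDistinctGtEven {2 * k + 1, 2 * k - 1, 2 * k + j - 7, 3, 2, 2} := by
  obtain ⟨i, hi, rfl⟩ : ∃ i ≤ 2, j = 2 * i := by
    fin_cases hj
    exacts [⟨0, by simp⟩, ⟨1, by simp⟩, ⟨2, by simp⟩]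
  have h : ({2 * k + 1, 2 * k - 1, 2 * k + 2 * i - 7, 3, 2, 2} : Multiset ℕ) =
    ↑[2 * k + 1, 2 * (k - 1) + 1, 2 * (k + i - 4) + 1, 2 * 1 + 1, 2 * 1, 2 * 1] := by
    rw [show 2 * k + 2 * i - 7 = 2 * (k + i - 4) + 1 by omega,
      show 2 * k - 1 = 2 * (k - 1) + 1 by omega]
    rfl
  rw [h]
  apply oddDistinctGtEven_coe
  simp [parity_simps]
  omega

theorem strict_inequality_with_witness (n : ℕ) (hn : 373 ≤ n) :
    podeu n + 1 ≤ peuod n ∧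
    ∃ (q : {p : n.Partition // OddDistinctGtEven p.parts})
      (f : {p : n.Partition // EvenGtOddDistinct p.parts} →
           {p : n.Partition // OddDistinctGtEven p.parts}),
      Function.Injective f ∧ q ∉ Set.range f ∧
      ((∃ k j, j ∈ ({1, 3, 5} : Finset ℕ) ∧ n = 6 * k + j ∧
          q.val.parts = ({2 * k + 3, 2 * k + 1, 2 * k + j - 8, 2, 2} : Multiset ℕ)) ∨
       (∃ k j, j ∈ ({0, 2, 4} : Finset ℕ) ∧ n = 6 * k + j ∧
          q.val.parts = ({2 * k + 1, 2 * k - 1, 2 * k + j - 7, 3, 2, 2} : Multiset ℕ))) := by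
  have hlt : podeu n < peuod n := podeu_lt_peuod (by omega)
  refine ⟨hlt, ?_⟩
  have hn' : n = 6 * (n / 6) + n % 6 := (Nat.div_add_mod n 6).symm
  have hj : n % 6 < 6 := Nat.mod_lt _ (by norm_num)
  generalize n / 6 = k at hn'
  generalize n % 6 = j at hn' hj
  by_cases hodd : j % 2 = 1
  · have hj' : j ∈ ({1, 3, 5} : Finset ℕ) := by
      simp only [Finset.mem_insert, Finset.mem_singleton]
      omega
    let q : {p : n.Partition // OddDistinctGtEven p.parts} :=
      ⟨⟨{2 * k + 3, 2 * k + 1, 2 * k + j - 8, 2, 2}, fun {i} hi => by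
        simp only [Multiset.insert_eq_cons, Multiset.mem_cons, Multiset.mem_singleton] at hi
        omega, by
        simp only [Multiset.insert_eq_cons, Multiset.sum_cons, Multiset.sum_singleton]
        omega⟩, oddDistinctGtEven_of_odd (by omega) hj'⟩
    obtain ⟨f, hf, hq⟩ := exists_injective_notMem_range hlt q
    exact ⟨q, f, hf, hq, Or.inl ⟨k, j, hj', hn', rfl⟩⟩
  · have hj' : j ∈ ({0, 2, 4} : Finset ℕ) := by
      simp only [Finset.mem_insert, Finset.mem_singleton]
      omega
    let q : {p : n.Partition // OddDistinctGtEven p.parts} :=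
      ⟨⟨{2 * k + 1, 2 * k - 1, 2 * k + j - 7, 3, 2, 2}, fun {i} hi => by
        simp only [Multiset.insert_eq_cons, Multiset.mem_cons, Multiset.mem_singleton] at hi
        omega, by
        simp only [Multiset.insert_eq_cons, Multiset.sum_cons, Multiset.sum_singleton]
        omega⟩, oddDistinctGtEven_of_even (by omega) hj'⟩
    obtain ⟨f, hf, hq⟩ := exists_injective_notMem_range hlt q
    exact ⟨q, f, hf, hq, Or.inr ⟨k, j, hj', hn', rfl⟩⟩
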